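/- Let E be a real inner product space, f : E → ℝ a differentiable convex function, h : E → ℝ ∪ {∞} a proper closed convex function, and suppose φ = f + h is μ-strongly convex where μ > 0. Let L > 0, x̃ ∈ E, let y be the minimizer over E of u ↦ ℓ_f(u; x̃) + h(u) + (L/2)‖u − x̃‖², set s = L(x̃ − y), and define γ(x) = φ(y) + 2[ℓ_f(y; x̃) − f(y)] + ⟨s, x − y⟩ + (μ/4)‖x − y‖². Then γ(x) ≤ φ(x) for all x ∈ E. -/

import Mathlib

noncomputable section

open RealInnerProductSpace

variable {E : Type*} [NormedAddCommGroup E] [InnerProductSpace ℝ E]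

/-- Convexity of an extended-real-valued function. -/
def ERealConvexOn (φ : E → EReal) : Prop :=
  ∀ x y : E, ∀ a b : ℝ, 0 ≤ a → 0 ≤ b → a + b = 1 →
    φ (a • x + b • y) ≤ (a : EReal) * φ x + (b : EReal) * φ y

/-- `φ` is μ-strongly convex if `φ − (μ/2)‖·‖²` is convex. -/
def ERealStrongConvexOn (μ : ℝ) (φ : E → EReal) : Prop :=
  ERealConvexOn (fun z => φ z - ((μ / 2 * ‖z‖ ^ 2 : ℝ) : EReal))

/-- A function `E → ℝ ∪ {∞}` is proper if it is not identically `∞`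
(and never takes the value `−∞`). -/
def ProperFun (φ : E → EReal) : Prop := (∀ z, φ z ≠ ⊥) ∧ ∃ z, φ z ≠ ⊤

lemma aux_grad (f : E → ℝ) (g a b : E) (hf : HasFDerivAt f ((innerSL ℝ) g) a)
    (hc : ConvexOn ℝ Set.univ f) : f a + ⟪g, b - a⟫ ≤ f b := by
  have h1 : HasDerivAt (fun t : ℝ => a + t • (b - a)) (b - a) 0 := by
    simpa using ((hasDerivAt_id (0 : ℝ)).smul_const (b - a)).const_add a
  have h2 : HasDerivAt (fun t : ℝ => f (a + t • (b - a))) ⟪g, b - a⟫ 0 := by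
    have h3 : HasFDerivAt f ((innerSL ℝ) g) (a + (0 : ℝ) • (b - a)) := by simpa using hf
    exact h3.comp_hasDerivAt (0 : ℝ) h1
  have h4 : ConvexOn ℝ Set.univ (fun t : ℝ => f (a + t • (b - a))) := by
    refine ⟨convex_univ, ?_⟩
    intro p _ q _ c d hc0 hd0 hcd
    have := hc.2 (Set.mem_univ (a + p • (b - a))) (Set.mem_univ (a + q • (b - a))) hc0 hd0 hcd
    have e : a + (c • p + d • q) • (b - a)
        = c • (a + p • (b - a)) + d • (a + q • (b - a)) := by
      have : a = (c + d) • a := by rw [hcd, one_smul]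
      simp only [smul_eq_mul]
      nth_rewrite 1 [this]
      module
    simp only [e]
    exact this
  have h5 := h4.le_slope_of_hasDerivAt (Set.mem_univ 0) (Set.mem_univ 1) one_pos h2
  simp [slope_def_field] at h5
  linarith

lemma aux_conv (h : E → EReal) (hb : ∀ z, h z ≠ ⊥) (hc : ERealConvexOn h) (x y : E) (p q : ℝ)
    (hx : h x = p) (hy : h y = q) (a b : ℝ) (ha : 0 ≤ a) (hb0 : 0 ≤ b) (hab : a + b = 1) :
    ∃ r : ℝ, h (a • x + b • y) = r ∧ r ≤ a * p + b * q := by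
  have := hc x y a b ha hb0 hab
  rw [hx, hy] at this
  have e : (a : EReal) * p + (b : EReal) * q = ((a * p + b * q : ℝ) : EReal) := by push_cast; rfl
  rw [e] at this
  have ht : h (a • x + b • y) ≠ ⊤ := fun hh => by
    rw [hh] at this; exact absurd this (not_le.mpr (EReal.coe_lt_top _))
  refine ⟨(h (a • x + b • y)).toReal, (EReal.coe_toReal ht (hb _)).symm, ?_⟩
  rw [← EReal.coe_le_coe_iff, EReal.coe_toReal ht (hb _)]
  exact this

/-- Lemma A.5: if `φ = f + h` is μ-strongly convex, `y` is the prox step at `xt`,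
`s = L(xt − y)`, and `γ` is the estimate-sequence function
`γ(x) = φ(y) + 2[ℓ_f(y; xt) − f(y)] + ⟨s, x − y⟩ + (μ/4)‖x − y‖²`, then `γ ≤ φ`. -/
theorem estimate_sequence_minorizes
    (f : E → ℝ) (f' : E → E) (hf : ∀ x : E, HasFDerivAt f ((innerSL ℝ) (f' x)) x)
    (hfconv : ConvexOn ℝ Set.univ f)
    (h : E → EReal) (hproper : ProperFun h) (hclosed : LowerSemicontinuous h)
    (hconvh : ERealConvexOn h)
    (μ : ℝ) (hμ : 0 < μ)
    (hφsc : ERealStrongConvexOn μ (fun x => ((f x : ℝ) : EReal) + h x))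
    (L : ℝ) (hL : 0 < L) (xt y : E)
    (hy : ∀ u : E,
      ((f xt + ⟪f' xt, y - xt⟫ + L / 2 * ‖y - xt‖ ^ 2 : ℝ) : EReal) + h y ≤
      ((f xt + ⟪f' xt, u - xt⟫ + L / 2 * ‖u - xt‖ ^ 2 : ℝ) : EReal) + h u)
    (s : E) (hs : s = L • (xt - y))
    (γ : E → EReal)
    (hγ : ∀ x : E, γ x = ((f y : ℝ) : EReal) + h y +
      ((2 * ((f xt + ⟪f' xt, y - xt⟫) - f y) + ⟪s, x - y⟫ + μ / 4 * ‖x - y‖ ^ 2 : ℝ) : EReal)) :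
    ∀ x : E, γ x ≤ ((f x : ℝ) : EReal) + h x := by
  intro x
  obtain ⟨hb, z, hz⟩ := hproper
  by_cases hx : h x = ⊤
  · rw [hx, EReal.coe_add_top]; exact le_top
  have hyt : h y ≠ ⊤ := fun hh => by
    have := hy z
    rw [hh, EReal.coe_add_top, ← EReal.coe_toReal hz (hb z), ← EReal.coe_add] at this
    exact absurd this (not_le.mpr (EReal.coe_lt_top _))
  obtain ⟨p, hp⟩ : ∃ p : ℝ, h x = p := ⟨_, (EReal.coe_toReal hx (hb x)).symm⟩
  obtain ⟨q, hq⟩ : ∃ q : ℝ, h y = q := ⟨_, (EReal.coe_toReal hyt (hb y)).symm⟩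
  obtain ⟨r, hr, -⟩ := aux_conv h hb hconvh x y p q hp hq (1/2) (1/2) (by norm_num) (by norm_num)
    (by norm_num)
  have hsc := hφsc x y (1/2) (1/2) (by norm_num) (by norm_num) (by norm_num)
  simp only [hr, hp, hq] at hsc
  rw [hγ, hp, hq]
  norm_cast at hsc ⊢
  obtain ⟨m, hm⟩ : ∃ m : E, m = (1/2 : ℝ) • x + (1/2 : ℝ) • y := ⟨_, rfl⟩
  rw [← hm] at hsc hr
  have hg := aux_grad f (f' xt) xt m (hf xt) hfconv
  -- optimality of the prox step
  have hopt : ∀ t : ℝ, 0 < t → t ≤ 1 →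
      ⟪f' xt, y - m⟫ + q - r - L * ⟪y - xt, m - y⟫ ≤ t * (L / 2 * ‖m - y‖ ^ 2) := by
    intro t ht0 ht1
    obtain ⟨w, hw, hwle⟩ := aux_conv h hb hconvh m y r q hr hq t (1 - t) ht0.le (by linarith)
      (by ring)
    have h1 := hy (t • m + (1 - t) • y)
    rw [hw, hq] at h1
    norm_cast at h1
    have e : t • m + (1 - t) • y - xt = (y - xt) + t • (m - y) := by module
    have e2 : ⟪f' xt, y - m⟫ = - ⟪f' xt, m - y⟫ := by rw [← inner_neg_right, neg_sub]
    rw [e, norm_add_sq_real, inner_add_right, real_inner_smul_right, real_inner_smul_right,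
      norm_smul, mul_pow, Real.norm_eq_abs, sq_abs] at h1
    rw [e2]
    refine le_of_mul_le_mul_left ?_ ht0
    nlinarith
  have hopt0 : ⟪f' xt, y - m⟫ + q - r - L * ⟪y - xt, m - y⟫ ≤ 0 := by
    by_contra hcon
    push Not at hcon
    set K := ⟪f' xt, y - m⟫ + q - r - L * ⟪y - xt, m - y⟫
    set N := L / 2 * ‖m - y‖ ^ 2
    have hN : 0 ≤ N := by positivity
    have h1 := hopt (K / (K + N + 1) / 1) (by positivity) (by
      rw [div_one, div_le_one (by positivity)]; linarith)
    rw [div_one, div_mul_eq_mul_div, le_div_iff₀ (by positivity)] at h1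
    nlinarith
  have em : m - y = (1/2 : ℝ) • (x - y) := by rw [hm]; module
  have e1 : ⟪f' xt, y - m⟫ = ⟪f' xt, y - xt⟫ - ⟪f' xt, m - xt⟫ := by
    rw [← inner_sub_right]; congr 1; abel
  have e3 : ⟪s, x - y⟫ = - L * ⟪y - xt, x - y⟫ := by
    rw [hs, real_inner_smul_left, ← neg_sub y xt, inner_neg_left]; ring
  rw [e1, em, real_inner_smul_right] at hopt0
  have e4 : ‖m‖ ^ 2 = 1/2 * ‖x‖ ^ 2 + 1/2 * ‖y‖ ^ 2 - 1/4 * ‖x - y‖ ^ 2 := by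
    rw [hm, norm_sub_sq_real, norm_add_sq_real, norm_smul, norm_smul, real_inner_smul_left,
      real_inner_smul_right]
    norm_num
    ring
  rw [e4] at hsc
  rw [e3]
  linarith
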